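/- arXiv:1707.04226 — 2 statements merged into one kernel-verified Lean document; each statement's English description precedes it below -/
import Mathlib

section
/- Let f : M → ℝ³ be a C^∞ immersion of a surface M into ℝ³ endowed with a smooth, strictly convex norm ‖·‖, and let η : M → ℝ³ be a Birkhoff normal field, i.e. a smooth map with ‖η(p)‖ = 1 and η(p) ⊣_B T_pM for every p ∈ M. Then the immersion endowed with the transversal field η is equiaffine: for every p ∈ M and every X ∈ T_pM, the derivative dη_p(X) lies in T_pM (equivalently, the 1-form τ in the Weingarten formula D_Xη = −SX + τ(X)η vanishes identically). -/
/-!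
Differential geometry of immersed surfaces in three-dimensional normed
(Minkowski) spaces, following Balestro–Martini–Teixeira.

`E3 = ℝ³` carries its standard Euclidean inner product and, in addition, a
norm `N` which is strictly convex and smooth.  Surfaces are given in a local
parametrization `f : P2 → E3` (an immersion on an open set `U`), endowed with
a Birkhoff normal field `η`.
-/

noncomputable section

open scoped InnerProductSpace

abbrev E3 := EuclideanSpace ℝ (Fin 3)
abbrev P2 := EuclideanSpace ℝ (Fin 2)

/-- A smooth, strictly convex norm on `ℝ³` (a Minkowski norm). -/
structure MinkowskiNorm3 where
  N : E3 → ℝ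
  nonneg : ∀ x, 0 ≤ N x
  eq_zero_iff : ∀ x, N x = 0 ↔ x = 0
  smul_eq : ∀ (c : ℝ) (x : E3), N (c • x) = |c| * N x
  triangle : ∀ x y, N (x + y) ≤ N x + N y
  strict_triangle : ∀ x y : E3, LinearIndependent ℝ ![x, y] → N (x + y) < N x + N y
  smooth : ContDiffOn ℝ (⊤ : ℕ∞) N {x : E3 | x ≠ 0}

namespace MinkowskiNorm3

/-- Birkhoff orthogonality of a vector `v` to a set (e.g. a plane) `H`:
`‖v + w‖ ≥ ‖v‖` for all `w ∈ H`. -/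
def BirkhoffOrth (m : MinkowskiNorm3) (v : E3) (H : Set E3) : Prop :=
  ∀ w ∈ H, m.N v ≤ m.N (v + w)

/-- The (outward) Euclidean Gauss map of the unit sphere `∂B` of the norm,
expressed on ambient space as the normalized gradient of `N`.  Restricted to
`∂B` it is the map `u⁻¹ : ∂B → ∂B_e`, whose inverse is `u : ∂B_e → ∂B`. -/
def sphereGauss (m : MinkowskiNorm3) (v : E3) : E3 :=
  ‖gradient m.N v‖⁻¹ • gradient m.N v

/-- The differential `du⁻¹` at a point `v ∈ ∂B`, applied to a vector `w`
(its restriction to the tangent plane of `∂B` at `v` is the inverse of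
`du_{u⁻¹(v)}`). -/
def duInv (m : MinkowskiNorm3) (v w : E3) : E3 :=
  fderiv ℝ m.sphereGauss v w

/-- Admissibility of the norm: the unit sphere `∂B` has positive Euclidean
Gaussian curvature at every point; equivalently, the second fundamental form
of `∂B` with respect to the outward normal is positive definite, i.e.
`⟪du⁻¹ w, w⟫ > 0` for every nonzero vector `w` tangent to `∂B`. -/
def Admissible (m : MinkowskiNorm3) : Prop :=
  ∀ v : E3, m.N v = 1 → ∀ w : E3, w ≠ 0 → fderiv ℝ m.N v w = 0 →
    0 < ⟪m.duInv v w, w⟫_ℝ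

end MinkowskiNorm3

/-- An immersed surface (in a local parametrization on an open set `U ⊆ ℝ²`)
in the Minkowski space `(ℝ³, m)`, endowed with a Birkhoff normal vector
field `η`: a smooth unit field with `η(p) ⊣_B T_pM` for all `p`. -/
structure BSurface (m : MinkowskiNorm3) where
  U : Set P2
  isOpen : IsOpen U
  f : P2 → E3
  smooth_f : ContDiffOn ℝ (⊤ : ℕ∞) f U
  immersion : ∀ p ∈ U, Function.Injective (fderiv ℝ f p)
  η : P2 → E3
  smooth_η : ContDiffOn ℝ (⊤ : ℕ∞) η U
  unit_η : ∀ p ∈ U, m.N (η p) = 1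
  birkhoff : ∀ p ∈ U, m.BirkhoffOrth (η p) (Set.range (fderiv ℝ f p))

namespace BSurface

variable {m : MinkowskiNorm3}

/-- The tangent plane `T_pM`, identified (via the push-forward `df_p`) with a
linear plane in ambient `ℝ³`. -/
def tangent (S : BSurface m) (p : P2) : Set E3 := Set.range (fderiv ℝ S.f p)

/-- `h : P2 → P2 → ℝ` (in the parameter coordinates, i.e. `h v w` stands for
`h(df_p v, df_p w)`) is the affine fundamental form of the immersion at `p`,
determined by the Gauss formula `D_X Y = ∇_X Y + h(X,Y) η`: for coordinate
directions `v, w`, the second derivative `D_v D_w f` minus `h v w • η p` is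
tangential. -/
def IsAffineFundForm (S : BSurface m) (p : P2) (h : P2 → P2 → ℝ) : Prop :=
  ∀ v w : P2,
    fderiv ℝ (fun q => fderiv ℝ S.f q w) p v - h v w • S.η p ∈ S.tangent p

end BSurface

/-- The Minkowski normal curvature of the surface parametrized by `f` with
Birkhoff normal field `η`, at `p`, in the tangent direction `X = df_p v`:
`k_{M,p}(X) = ⟪du⁻¹_{η(p)} X, dη_p X⟫ / ⟪du⁻¹_{η(p)} X, X⟫`, using the natural
identification of the parallel planes `T_pM ≅ T_{η(p)}∂B ≅ T_{ξ(p)}∂B_e`. -/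
def normalCurv (m : MinkowskiNorm3) (f η : P2 → E3) (p v : P2) : ℝ :=
  ⟪m.duInv (η p) (fderiv ℝ f p v), fderiv ℝ η p v⟫_ℝ /
    ⟪m.duInv (η p) (fderiv ℝ f p v), fderiv ℝ f p v⟫_ℝ

namespace MinkowskiNorm3

variable (m : MinkowskiNorm3)

theorem differentiableAt_N {v : E3} (hv : v ≠ 0) : DifferentiableAt ℝ m.N v :=
  (m.smooth.contDiffAt (isOpen_ne.mem_nhds hv)).differentiableAt (by simp)

/-- Euler's identity for the norm, which is homogeneous of degree one. -/
theorem fderiv_N_self {v : E3} (hv : v ≠ 0) : fderiv ℝ m.N v v = m.N v := by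
  have h := (m.differentiableAt_N hv).hasFDerivAt
  have hline : HasDerivAt (fun t : ℝ => v + t • v) v 0 := by
    simpa using ((hasDerivAt_id (0 : ℝ)).smul_const v).const_add v
  have hcomp : HasDerivAt (fun t : ℝ => m.N (v + t • v)) (fderiv ℝ m.N v v) 0 :=
    HasFDerivAt.comp_hasDerivAt (0 : ℝ) (by simpa using h) hline
  have hlin : HasDerivAt (fun t : ℝ => (1 + t) * m.N v) (m.N v) 0 := by
    simpa using ((hasDerivAt_id (0 : ℝ)).const_add 1).mul_const (m.N v)
  refine hcomp.unique (hlin.congr_of_eventuallyEq ?_)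
  filter_upwards [lt_mem_nhds (show (-1 : ℝ) < 0 by norm_num)] with t ht
  rw [show v + t • v = (1 + t) • v by rw [add_smul, one_smul], m.smul_eq,
    abs_of_pos (by linarith)]

/-- If `v` is Birkhoff orthogonal to a subspace, then the differential of the norm at `v`
vanishes on that subspace. -/
theorem BirkhoffOrth.fderiv_eq_zero {m : MinkowskiNorm3} {v w : E3} {H : Submodule ℝ E3}
    (h : m.BirkhoffOrth v H) (hv : v ≠ 0) (hw : w ∈ H) : fderiv ℝ m.N v w = 0 := by
  have hd := (m.differentiableAt_N hv).hasFDerivAt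
  have hline : HasDerivAt (fun t : ℝ => v + t • w) w 0 := by
    simpa using ((hasDerivAt_id (0 : ℝ)).smul_const w).const_add v
  have hcomp : HasDerivAt (fun t : ℝ => m.N (v + t • w)) (fderiv ℝ m.N v w) 0 :=
    HasFDerivAt.comp_hasDerivAt (0 : ℝ) (by simpa using hd) hline
  have hmin : IsLocalMin (fun t : ℝ => m.N (v + t • w)) 0 :=
    Filter.Eventually.of_forall fun t => by simpa using h _ (H.smul_mem t hw)
  exact hmin.hasDerivAt_eq_zero hcomp

end MinkowskiNorm3

/-- An injective image of the plane contained in the kernel of a nonzero functional on `ℝ³`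
is the whole kernel. -/
theorem range_eq_ker_of_injective {A : P2 →ₗ[ℝ] E3} {L : E3 →ₗ[ℝ] ℝ}
    (hA : Function.Injective A) (hL : L ≠ 0) (h : LinearMap.range A ≤ LinearMap.ker L) :
    LinearMap.range A = LinearMap.ker L := by
  refine Submodule.eq_of_le_of_finrank_eq h ?_
  have hker := L.finrank_range_add_finrank_ker
  rw [LinearMap.range_eq_top.2 (LinearMap.surjective hL), finrank_top] at hker
  rw [LinearMap.finrank_range_of_inj hA]
  simp at hker ⊢
  omega

namespace BSurface

variable {m : MinkowskiNorm3} (S : BSurface m)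

theorem η_ne_zero {p : P2} (hp : p ∈ S.U) : S.η p ≠ 0 := fun h0 => by
  have h1 := S.unit_η p hp
  rw [(m.eq_zero_iff _).2 h0] at h1
  exact zero_ne_one h1

theorem fderiv_N_fderiv_η {p : P2} (hp : p ∈ S.U) (v : P2) :
    fderiv ℝ m.N (S.η p) (fderiv ℝ S.η p v) = 0 := by
  have hU := S.isOpen.mem_nhds hp
  have hη : DifferentiableAt ℝ S.η p := (S.smooth_η.contDiffAt hU).differentiableAt (by simp)
  have hcomp := fderiv_comp p (m.differentiableAt_N (S.η_ne_zero hp)) hη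
  have hconst : m.N ∘ S.η =ᶠ[nhds p] fun _ => (1 : ℝ) := by
    filter_upwards [hU] with q hq using S.unit_η q hq
  rw [hconst.fderiv_eq, fderiv_fun_const] at hcomp
  simpa using (DFunLike.congr_fun hcomp v).symm

end BSurface

/-- A surface immersion endowed with the Birkhoff normal
vector field is an equiaffine immersion: the derivative of `η` is always
tangential (the 1-form `τ` of the Weingarten formula vanishes). -/
theorem birkhoff_normal_is_equiaffine (m : MinkowskiNorm3) (S : BSurface m) :
    ∀ p ∈ S.U, ∀ v : P2, fderiv ℝ S.η p v ∈ S.tangent p := by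
  intro p hp v
  have hne := S.η_ne_zero hp
  let A : P2 →ₗ[ℝ] E3 := (fderiv ℝ S.f p).toLinearMap
  let L : E3 →ₗ[ℝ] ℝ := (fderiv ℝ m.N (S.η p)).toLinearMap
  have hL : L ≠ 0 := fun h0 => by
    have h1 : fderiv ℝ m.N (S.η p) (S.η p) = 0 := DFunLike.congr_fun h0 (S.η p)
    rw [m.fderiv_N_self hne, S.unit_η p hp] at h1
    exact one_ne_zero h1
  have horth : m.BirkhoffOrth (S.η p) (LinearMap.range A) := S.birkhoff p hp
  have hrange := range_eq_ker_of_injective (S.immersion p hp) hL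
    fun w hw => horth.fderiv_eq_zero hne hw
  have hmem : fderiv ℝ S.η p v ∈ LinearMap.range A := by
    rw [hrange]
    exact S.fderiv_N_fderiv_η hp v
  exact hmem
end
end

section
/- Let f : M → ℝ³ be a connected immersed surface, endowed with a Birkhoff normal field η, all of whose points are umbilic (i.e. at every p ∈ M the differential dη_p is a scalar multiple λ(p) of the identity of T_pM). Then M is contained in a plane or in a Minkowski sphere, i.e. in a set of the form {x ∈ ℝ³ : ‖x − c‖ = ρ} for some c ∈ ℝ³ and ρ > 0. -/
/-!
Differential geometry of immersed surfaces in three-dimensional normed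
(Minkowski) spaces, following Balestro–Martini–Teixeira.

`E3 = ℝ³` carries its standard Euclidean inner product and, in addition, a
norm `N` which is strictly convex and smooth.  Surfaces are given in a local
parametrization `f : P2 → E3` (an immersion on an open set `U`), endowed with
a Birkhoff normal field `η`.
-/

noncomputable section

open scoped InnerProductSpace

namespace MinkowskiNorm3

theorem differentiableAt (m : MinkowskiNorm3) {x : E3} (hx : x ≠ 0) :
    DifferentiableAt ℝ m.N x :=
  ((m.smooth x hx).contDiffAt (isOpen_ne.mem_nhds hx)).differentiableAt (by simp)

/-- Euler's identity for the norm, which is positively homogeneous of degree one. -/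
theorem fderiv_self (m : MinkowskiNorm3) {x : E3} (hx : x ≠ 0) :
    fderiv ℝ m.N x x = m.N x := by
  have h1 : HasDerivAt (fun t : ℝ => x + t • x) x 0 := by
    simpa using ((hasDerivAt_id (0 : ℝ)).smul_const x).const_add x
  have h2 : HasDerivAt (fun t : ℝ => m.N (x + t • x)) (fderiv ℝ m.N x x) 0 := by
    have h := (m.differentiableAt hx).hasFDerivAt
    exact HasFDerivAt.comp_hasDerivAt (0 : ℝ) (by simpa using h) h1
  have h3 : HasDerivAt (fun t : ℝ => (1 + t) * m.N x) (m.N x) 0 := by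
    simpa using ((hasDerivAt_id (0 : ℝ)).const_add 1).mul_const (m.N x)
  refine h2.unique (h3.congr_of_eventuallyEq ?_)
  filter_upwards [lt_mem_nhds (show (-1 : ℝ) < 0 by norm_num)] with t ht
  rw [show x + t • x = (1 + t) • x by rw [add_smul, one_smul], m.smul_eq,
    abs_of_pos (by linarith)]

/-- The norm is stationary at `x` in every direction of a line to which `x` is
Birkhoff orthogonal. -/
theorem fderiv_eq_zero_of_forall_le (m : MinkowskiNorm3) {x w : E3} (hx : x ≠ 0)
    (h : ∀ t : ℝ, m.N x ≤ m.N (x + t • w)) : fderiv ℝ m.N x w = 0 := by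
  have h1 : HasDerivAt (fun t : ℝ => x + t • w) w 0 := by
    simpa using ((hasDerivAt_id (0 : ℝ)).smul_const w).const_add x
  have h2 : HasDerivAt (fun t : ℝ => m.N (x + t • w)) (fderiv ℝ m.N x w) 0 := by
    have h := (m.differentiableAt hx).hasFDerivAt
    exact HasFDerivAt.comp_hasDerivAt (0 : ℝ) (by simpa using h) h1
  refine IsLocalMin.hasDerivAt_eq_zero (Filter.Eventually.of_forall fun t => ?_) h2
  simpa using h t

end MinkowskiNorm3

/-- If the differentials of two maps of the plane are proportional and one of them is
injective, then the factor of proportionality is differentiable with vanishing derivative. -/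
theorem hasFDerivAt_zero_of_fderiv_eq_smul {F : Type*} [NormedAddCommGroup F]
    [InnerProductSpace ℝ F] {f g : P2 → F} {lam : P2 → ℝ} {p : P2}
    (hf : ContDiffAt ℝ 2 f p) (hg : ContDiffAt ℝ 2 g p)
    (hinj : Function.Injective (fderiv ℝ f p))
    (hfg : ∀ᶠ q in nhds p, fderiv ℝ g q = lam q • fderiv ℝ f q) :
    HasFDerivAt lam (0 : P2 →L[ℝ] ℝ) p := by
  have hf' : DifferentiableAt ℝ (fderiv ℝ f) p :=
    (hf.fderiv_right (m := 1) (by norm_num)).differentiableAt (by simp)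
  have hg' : DifferentiableAt ℝ (fderiv ℝ g) p :=
    (hg.fderiv_right (m := 1) (by norm_num)).differentiableAt (by simp)
  set e₀ : P2 := EuclideanSpace.single 0 1
  set e₁ : P2 := EuclideanSpace.single 1 1
  have he₀ : fderiv ℝ f p e₀ ≠ 0 := fun h => by
    have := congrArg (fun v : P2 => v 0) (hinj (h.trans (map_zero _).symm))
    simp [e₀] at this
  have hfe : DifferentiableAt ℝ (fun q => fderiv ℝ f q e₀) p :=
    hf'.clm_apply (differentiableAt_const _)
  have hge : DifferentiableAt ℝ (fun q => fderiv ℝ g q e₀) p :=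
    hg'.clm_apply (differentiableAt_const _)
  have hlam : DifferentiableAt ℝ lam p := by
    have hne₀ : ⟪fderiv ℝ f p e₀, fderiv ℝ f p e₀⟫_ℝ ≠ 0 := inner_self_ne_zero.2 he₀
    have hnum := hge.inner ℝ hfe
    have hden := hfe.inner ℝ hfe
    have hquot : DifferentiableAt ℝ (fun q => ⟪fderiv ℝ g q e₀, fderiv ℝ f q e₀⟫_ℝ /
        ⟪fderiv ℝ f q e₀, fderiv ℝ f q e₀⟫_ℝ) p := by
      fun_prop (disch := exact hne₀)
    refine hquot.congr_of_eventuallyEq ?_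
    filter_upwards [hfg, hfe.continuousAt.eventually_ne he₀] with q hq hne
    have : ⟪fderiv ℝ f q e₀, fderiv ℝ f q e₀⟫_ℝ ≠ 0 := inner_self_ne_zero.2 hne
    rw [hq, _root_.smul_apply, real_inner_smul_left, mul_div_cancel_right₀ _ this]
  have hD : fderiv ℝ (fderiv ℝ g) p = fderiv ℝ (fun q => lam q • fderiv ℝ f q) p :=
    Filter.EventuallyEq.fderiv_eq hfg
  rw [fderiv_fun_smul hlam hf'] at hD
  have hsf : fderiv ℝ (fderiv ℝ f) p e₀ e₁ = fderiv ℝ (fderiv ℝ f) p e₁ e₀ :=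
    (hf.isSymmSndFDerivAt (by simp)) e₀ e₁
  have hsg : fderiv ℝ (fderiv ℝ g) p e₀ e₁ = fderiv ℝ (fderiv ℝ g) p e₁ e₀ :=
    (hg.isSymmSndFDerivAt (by simp)) e₀ e₁
  have key : fderiv ℝ f p (fderiv ℝ lam p e₀ • e₁) =
      fderiv ℝ f p (fderiv ℝ lam p e₁ • e₀) := by
    simpa [hD, hsf] using hsg
  have hv := hinj key
  have h₀ : fderiv ℝ lam p e₀ = 0 := by
    simpa [e₀, e₁] using congrArg (fun v : P2 => v 1) hv
  have h₁ : fderiv ℝ lam p e₁ = 0 := by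
    simpa [e₀, e₁] using (congrArg (fun v : P2 => v 0) hv).symm
  have hzero : fderiv ℝ lam p = 0 := by
    ext v
    have : v = v 0 • e₀ + v 1 • e₁ := by
      ext i
      fin_cases i <;> simp [e₀, e₁]
    rw [this]
    simp [h₀, h₁]
  exact hzero ▸ hlam.hasFDerivAt

/-- A connected immersed surface all of whose points are
umbilic is contained in a plane or in a Minkowski sphere. -/
theorem all_umbilic_plane_or_sphere (m : MinkowskiNorm3) (S : BSurface m)
    (hconn : IsConnected S.U)
    (humb : ∀ p ∈ S.U, ∃ lam : ℝ, ∀ v : P2,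
      fderiv ℝ S.η p v = lam • fderiv ℝ S.f p v) :
    (∃ a : E3, a ≠ 0 ∧ ∃ c : ℝ, ∀ q ∈ S.U, ⟪a, S.f q⟫_ℝ = c) ∨
    (∃ cc : E3, ∃ ρ : ℝ, 0 < ρ ∧ ∀ q ∈ S.U, m.N (S.f q - cc) = ρ) := by
  obtain ⟨p₀, hp₀⟩ := hconn.nonempty
  have hnhds {p : P2} (hp : p ∈ S.U) : S.U ∈ nhds p := S.isOpen.mem_nhds hp
  have hfS : ∀ p ∈ S.U, ContDiffAt ℝ (⊤ : ℕ∞) S.f p := fun p hp =>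
    S.smooth_f.contDiffAt (hnhds hp)
  have hηS : ∀ p ∈ S.U, ContDiffAt ℝ (⊤ : ℕ∞) S.η p := fun p hp =>
    S.smooth_η.contDiffAt (hnhds hp)
  have hdf : ∀ p ∈ S.U, DifferentiableAt ℝ S.f p := fun p hp =>
    (hfS p hp).differentiableAt (by simp)
  have hdη : ∀ p ∈ S.U, DifferentiableAt ℝ S.η p := fun p hp =>
    (hηS p hp).differentiableAt (by simp)
  choose! lam hlam using humb
  have hfg : ∀ p ∈ S.U, fderiv ℝ S.η p = lam p • fderiv ℝ S.f p := fun p hp =>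
    ContinuousLinearMap.ext (hlam p hp)
  have h2 : (2 : WithTop ℕ∞) ≤ ((⊤ : ℕ∞) : WithTop ℕ∞) :=
    WithTop.coe_le_coe.2 (le_top : (2 : ℕ∞) ≤ ⊤)
  have hlam' : ∀ p ∈ S.U, HasFDerivAt lam (0 : P2 →L[ℝ] ℝ) p := fun p hp =>
    hasFDerivAt_zero_of_fderiv_eq_smul ((hfS p hp).of_le h2)
      ((hηS p hp).of_le h2) (S.immersion p hp)
      (Filter.eventually_of_mem (hnhds hp) hfg)
  have hconst : ∀ p ∈ S.U, lam p = lam p₀ := fun p hp =>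
    S.isOpen.is_const_of_fderiv_eq_zero hconn.isPreconnected
      (fun q hq => (hlam' q hq).differentiableAt.differentiableWithinAt)
      (fun q hq => (hlam' q hq).fderiv) hp hp₀
  have hη₀ : S.η p₀ ≠ 0 := fun h => by
    have := S.unit_η p₀ hp₀
    rw [(m.eq_zero_iff _).2 h] at this
    exact zero_ne_one this
  by_cases h0 : lam p₀ = 0
  · left
    have hηc : ∀ p ∈ S.U, S.η p = S.η p₀ := fun p hp =>
      S.isOpen.is_const_of_fderiv_eq_zero hconn.isPreconnected
        (fun q hq => (hdη q hq).differentiableWithinAt)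
        (fun q hq => by simp [hfg q hq, hconst q hq, h0]) hp hp₀
    refine ⟨gradient m.N (S.η p₀), fun h => ?_, ⟪gradient m.N (S.η p₀), S.f p₀⟫_ℝ,
      fun q hq => ?_⟩
    · have h1 := m.fderiv_self hη₀
      rw [← inner_gradient_left, h, inner_zero_left, S.unit_η p₀ hp₀] at h1
      exact zero_ne_one h1
    · simp only [inner_gradient_left]
      refine S.isOpen.is_const_of_fderiv_eq_zero (f := fun x => fderiv ℝ m.N (S.η p₀) (S.f x))
        hconn.isPreconnected
        (fun x hx => ((fderiv ℝ m.N (S.η p₀)).differentiableAt.comp x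
          (hdf x hx)).differentiableWithinAt) (fun x hx => ?_) hq hp₀
      have hc := ((fderiv ℝ m.N (S.η p₀)).hasFDerivAt.comp x (hdf x hx).hasFDerivAt).fderiv
      refine hc.trans (ContinuousLinearMap.ext fun v => ?_)
      refine m.fderiv_eq_zero_of_forall_le hη₀ fun t => ?_
      rw [← hηc x hx]
      exact S.birkhoff x hx _ ⟨t • v, map_smul _ _ _⟩
  · right
    refine ⟨S.f p₀ - (lam p₀)⁻¹ • S.η p₀, |(lam p₀)⁻¹|, by positivity, fun q hq => ?_⟩
    have hderiv : ∀ x ∈ S.U,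
        HasFDerivAt (fun x => S.f x - (lam p₀)⁻¹ • S.η x) (0 : P2 →L[ℝ] E3) x := fun x hx => by
      have h := (hdf x hx).hasFDerivAt.fun_sub
        ((hdη x hx).hasFDerivAt.fun_const_smul (lam p₀)⁻¹)
      rwa [hfg x hx, hconst x hx, inv_smul_smul₀ h0, sub_self] at h
    have hc : S.f q - (lam p₀)⁻¹ • S.η q = S.f p₀ - (lam p₀)⁻¹ • S.η p₀ :=
      S.isOpen.is_const_of_fderiv_eq_zero hconn.isPreconnected
        (fun x hx => (hderiv x hx).differentiableAt.differentiableWithinAt)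
        (fun x hx => (hderiv x hx).fderiv) hq hp₀
    rw [← hc, sub_sub_cancel, m.smul_eq, S.unit_η q hq, mul_one]
end
end
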